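/- Let ℓ ≥ 1, n ≥ 0, let s = (s₀,…,s_{ℓ−1}) ∈ ℤ^ℓ with Σᵢ sᵢ = 0, and define m = (m⁰,…,m^{ℓ−1}) ∈ ℚ^ℓ by mⁱ = −sᵢ − i/ℓ for 0 ≤ i ≤ ℓ−1. Let λ, μ be ℓ-multipartitions of n and let d be an integer with d ≥ max(hc^λ, hc^μ) + 1. Then τ_s(ᵗλ) ⊲ τ_s(ᵗμ) if and only if κ^d_m(μ) ⊲ κ^d_m(λ), where ᵗλ = (ᵗλ¹,…,ᵗλ^ℓ) is the componentwise conjugate multipartition. -/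

import Mathlib

open scoped BigOperators

/-- `l` is (the list of parts of) a partition : a nonincreasing list of positive integers. -/
def IsPartitionList (l : List ℕ) : Prop := l.Pairwise (· ≥ ·) ∧ ∀ x ∈ l, 0 < x

/-- The β-sequence of a partition `λ` (written in increasing order) :
`(λ_h, …, λ_j − j + h, …, λ_1 − 1 + h)`, where `h` is the number of parts. -/
def betaRow (l : List ℕ) : List ℚ :=
  (List.range l.length).map (fun k => (l.getD (l.length - 1 - k) 0 : ℚ) + (k : ℚ))

/-- The shift `β(t)` of a finite sequence `β` by a rational `t ≥ 0` :
`β(t) = β` if `0 ≤ t < 1`, and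
`β(t) = (t−[t], t−[t]+1, …, t−1, β₁+t, …, β_k+t)` if `t ≥ 1`. -/
def shiftRow (β : List ℚ) (t : ℚ) : List ℚ :=
  if t < 1 then β
  else ((List.range (Int.toNat ⌊t⌋)).map (fun j => t - (⌊t⌋ : ℚ) + (j : ℚ))) ++
    β.map (· + t)

/-- The row `Bⁱ = βⁱ(d − hcⁱ)` of the shifted `m`-symbol of size `d`,
where `hcⁱ = h(λ^{i+1}) − mⁱ`. -/
def symbolRow (d : ℤ) (m : ℚ) (l : List ℕ) : List ℚ :=
  shiftRow (betaRow l) ((d : ℚ) - (l.length : ℚ) + m)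

/-- `κ^d_m(λ)` : all the entries of the shifted `m`-symbol of size `d` of the
`ℓ`-multipartition `λ`, written in nonincreasing order. -/
def kappa (ℓ : ℕ) (d : ℤ) (m : Fin ℓ → ℚ) (lam : Fin ℓ → List ℕ) : List ℚ :=
  List.insertionSort (fun a b : ℚ => b ≤ a)
    ((List.finRange ℓ).flatMap (fun i => symbolRow d (m i) (lam i)))

/-- Dominance (pre)order on finite rational sequences : every partial sum of `a`
is at most the corresponding partial sum of `b`. -/
def domLE (a b : List ℚ) : Prop :=
  ∀ i : ℕ, ∑ k ∈ Finset.range i, a.getD k 0 ≤ ∑ k ∈ Finset.range i, b.getD k 0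

/-- Strict dominance `a ⊲ b`. -/
def domLT (a b : List ℚ) : Prop := domLE a b ∧ a ≠ b

/-- `σ` is the conjugate (transposed) partition of `ρ`. -/
def IsConjPart (ρ σ : List ℕ) : Prop :=
  ∀ i j : ℕ, (j < ρ.getD i 0 ↔ i < σ.getD j 0)

/-- The β-set of a partition `ρ` with charge `s` :
`β_s(ρ)_j = ρ_{j+1} + s − j` (0-indexed). -/
def betaSet (ρ : List ℕ) (s : ℤ) : ℕ → ℤ := fun j => (ρ.getD j 0 : ℤ) + s - j

/-- The set `𝒯 = ⋃_{i=1}^ℓ 𝒯ᵢ`, where `𝒯ᵢ = {ℓ(x−1)+i : x ∈ β_{s_{i−1}}(λⁱ)}`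
(with `i : Fin ℓ` corresponding to the row index `i+1`). -/
def tauSet (ℓ : ℕ) (s : Fin ℓ → ℤ) (lam : Fin ℓ → List ℕ) : Set ℤ :=
  ⋃ i : Fin ℓ,
    (fun x : ℤ => (ℓ : ℤ) * (x - 1) + ((i : ℕ) + 1)) '' Set.range (betaSet (lam i) (s i))

/-- Dominance order for partitions (lists of naturals), via the rational one. -/
def domLTn (a b : List ℕ) : Prop :=
  domLT (a.map (fun x => (x : ℚ))) (b.map (fun x => (x : ℚ)))

theorem List.sum_map_range {M : Type*} [AddCommMonoid M] (f : ℕ → M) (n : ℕ) :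
    ((List.range n).map f).sum = ∑ j ∈ Finset.range n, f j :=
  rfl

theorem List.sum_eq_sum_range_getD {M : Type*} [AddCommMonoid M] (l : List M) :
    l.sum = ∑ j ∈ Finset.range l.length, l.getD j 0 := by
  induction l with
  | nil => simp
  | cons a l ih => simp [Finset.sum_range_succ', ih, add_comm]

theorem List.sum_eq_sum_range_getD_of_le {M : Type*} [AddCommMonoid M] (l : List M) {N : ℕ}
    (hN : l.length ≤ N) : l.sum = ∑ j ∈ Finset.range N, l.getD j 0 := by
  rw [List.sum_eq_sum_range_getD]
  refine Finset.sum_subset (Finset.range_mono hN) fun j _ hj => ?_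
  exact List.getD_eq_default _ _ (by simpa using hj)

theorem List.getD_antitone_of_pairwise {α : Type*} [Preorder α] {l : List α}
    (h : l.Pairwise (· ≥ ·)) (z : α) {i j : ℕ} (hij : i ≤ j) (hj : j < l.length) :
    l.getD j z ≤ l.getD i z := by
  rcases hij.eq_or_lt with rfl | hlt
  · exact le_rfl
  · rw [List.getD_eq_getElem _ _ hj, List.getD_eq_getElem _ _ (hlt.trans hj)]
    exact List.pairwise_iff_getElem.1 h i j (hlt.trans hj) hj hlt

/-! ### Dominance and sums of positive parts -/

theorem exists_threshold {a : ℕ → ℚ} {N : ℕ} (ha : ∀ i j, i ≤ j → j < N → a j ≤ a i) (c : ℚ) :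
    ∃ i ≤ N, (∀ j < i, c ≤ a j) ∧ ∀ j, i ≤ j → j < N → a j ≤ c := by
  induction N with
  | zero => exact ⟨0, le_rfl, by simp, by simp⟩
  | succ N ih =>
    rcases le_total c (a N) with h | h
    · exact ⟨N + 1, le_rfl, fun j hj => h.trans (ha j N (by omega) (by omega)),
        fun j h1 h2 => by omega⟩
    · obtain ⟨i, hi, h1, h2⟩ := ih fun i j hij hj => ha i j hij (by omega)
      refine ⟨i, by omega, h1, fun j hij hj => ?_⟩
      rcases Nat.lt_succ_iff_lt_or_eq.1 hj with h3 | rfl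
      · exact h2 j hij h3
      · exact h

theorem sum_posPart_eq {a : ℕ → ℚ} {i N : ℕ} {c : ℚ} (hi : i ≤ N) (h1 : ∀ j < i, c ≤ a j)
    (h2 : ∀ j, i ≤ j → j < N → a j ≤ c) :
    ∑ j ∈ Finset.range N, max (a j - c) 0 = ∑ j ∈ Finset.range i, (a j - c) := by
  rw [← Finset.sum_range_add_sum_Ico _ hi]
  have e1 : ∑ j ∈ Finset.range i, max (a j - c) 0 = ∑ j ∈ Finset.range i, (a j - c) :=
    Finset.sum_congr rfl fun j hj =>
      max_eq_left (sub_nonneg.2 (h1 j (Finset.mem_range.1 hj)))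
  have e2 : ∑ j ∈ Finset.Ico i N, max (a j - c) 0 = 0 :=
    Finset.sum_eq_zero fun j hj =>
      max_eq_right (sub_nonpos.2 (h2 j (Finset.mem_Ico.1 hj).1 (Finset.mem_Ico.1 hj).2))
  rw [e1, e2, add_zero]

theorem sum_sub_le_sum_posPart (a : ℕ → ℚ) {i N : ℕ} (c : ℚ) (hi : i ≤ N) :
    ∑ j ∈ Finset.range i, (a j - c) ≤ ∑ j ∈ Finset.range N, max (a j - c) 0 :=
  (Finset.sum_le_sum fun _ _ => le_max_left _ _).trans
    (Finset.sum_le_sum_of_subset_of_nonneg (Finset.range_mono hi) fun _ _ _ => le_max_right _ _)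

theorem sum_posPart_le_of_partial_sums {a b : ℕ → ℚ} {N : ℕ}
    (ha : ∀ i j, i ≤ j → j < N → a j ≤ a i)
    (h : ∀ i ≤ N, ∑ j ∈ Finset.range i, a j ≤ ∑ j ∈ Finset.range i, b j) (c : ℚ) :
    ∑ j ∈ Finset.range N, max (a j - c) 0 ≤ ∑ j ∈ Finset.range N, max (b j - c) 0 := by
  obtain ⟨i, hi, h1, h2⟩ := exists_threshold ha c
  rw [sum_posPart_eq hi h1 h2]
  refine le_trans ?_ (sum_sub_le_sum_posPart b c hi)
  rw [Finset.sum_sub_distrib, Finset.sum_sub_distrib]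
  exact sub_le_sub_right (h i hi) _

theorem partial_sum_le_of_sum_posPart {a b : ℕ → ℚ} {i N : ℕ} (hi : i < N)
    (hb : ∀ i j, i ≤ j → j < N → b j ≤ b i)
    (h : ∑ j ∈ Finset.range N, max (a j - b i) 0 ≤ ∑ j ∈ Finset.range N, max (b j - b i) 0) :
    ∑ j ∈ Finset.range (i + 1), a j ≤ ∑ j ∈ Finset.range (i + 1), b j := by
  rw [sum_posPart_eq (i := i + 1) hi (fun j hj => hb j i (by omega) hi)
    (fun j h1 h2 => hb i j (by omega) h2)] at h
  have := (sum_sub_le_sum_posPart a (b i) (i := i + 1) hi).trans h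
  rw [Finset.sum_sub_distrib, Finset.sum_sub_distrib] at this
  exact (sub_le_sub_iff_right _).1 this

theorem domLE_iff_sum_posPart {a b : List ℚ} (ha : a.Pairwise (· ≥ ·)) (hb : b.Pairwise (· ≥ ·))
    (hab : a.length = b.length) :
    domLE a b ↔ ∀ c : ℚ,
      (a.map fun x => max (x - c) 0).sum ≤ (b.map fun x => max (x - c) 0).sum := by
  have key : ∀ (l : List ℚ) (c : ℚ), (l.map fun x => max (x - c) 0).sum =
      ∑ j ∈ Finset.range l.length, max (l.getD j 0 - c) 0 := fun l c => by
    rw [List.sum_eq_sum_range_getD, List.length_map]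
    refine Finset.sum_congr rfl fun j hj => ?_
    rw [List.getD_eq_getElem _ _ (by simpa using hj),
      List.getD_eq_getElem _ _ (by simpa using hj), List.getElem_map]
  simp only [key, hab]
  constructor
  · intro h c
    exact sum_posPart_le_of_partial_sums
      (fun i j hij hj => List.getD_antitone_of_pairwise ha 0 hij (hab ▸ hj)) (fun i _ => h i) c
  · intro h
    have hle : ∀ i ≤ b.length,
        ∑ k ∈ Finset.range i, a.getD k 0 ≤ ∑ k ∈ Finset.range i, b.getD k 0 := by
      intro i hi
      rcases i with _ | i
      · simp
      · exact partial_sum_le_of_sum_posPart hi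
          (fun i j hij hj => List.getD_antitone_of_pairwise hb 0 hij hj) (h _)
    intro i
    rcases le_total i b.length with hi | hi
    · exact hle i hi
    · rw [← List.sum_eq_sum_range_getD_of_le _ (hab ▸ hi), ← List.sum_eq_sum_range_getD_of_le _ hi,
        List.sum_eq_sum_range_getD a, List.sum_eq_sum_range_getD b, hab]
      exact hle _ le_rfl

theorem getD_eq_of_domLE {a b : List ℚ} (hab : domLE a b) (hba : domLE b a) (i : ℕ) :
    a.getD i 0 = b.getD i 0 := by
  have h1 := le_antisymm (hab (i + 1)) (hba (i + 1))
  rw [Finset.sum_range_succ, Finset.sum_range_succ, le_antisymm (hab i) (hba i)] at h1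
  exact add_left_cancel h1

/-! ### Partitions and β-sets -/

theorem IsPartitionList.getD_antitone {l : List ℕ} (hl : IsPartitionList l) :
    Antitone fun j => l.getD j 0 := by
  intro i j hij
  rcases lt_or_ge j l.length with hj | hj
  · exact List.getD_antitone_of_pairwise hl.1 0 hij hj
  · exact (List.getD_eq_default _ _ hj).trans_le (Nat.zero_le _)

theorem IsPartitionList.getD_pos_iff {l : List ℕ} (hl : IsPartitionList l) (j : ℕ) :
    0 < l.getD j 0 ↔ j < l.length := by
  constructor
  · intro h
    by_contra hj
    rw [List.getD_eq_default _ _ (not_lt.1 hj)] at h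
    exact h.false
  · intro h
    rw [List.getD_eq_getElem _ _ h]
    exact hl.2 _ (List.getElem_mem h)

theorem IsPartitionList.ext {l l' : List ℕ} (hl : IsPartitionList l) (hl' : IsPartitionList l')
    (h : ∀ j, l.getD j 0 = l'.getD j 0) : l = l' := by
  have hlen : l.length = l'.length := by
    refine eq_of_forall_lt_iff fun j => ?_
    rw [← hl.getD_pos_iff, ← hl'.getD_pos_iff, h]
  refine List.ext_getElem hlen fun j h1 h2 => ?_
  have := h j
  rwa [List.getD_eq_getElem _ _ h1, List.getD_eq_getElem _ _ h2] at this

theorem IsPartitionList.betaSet_strictAnti {l : List ℕ} (hl : IsPartitionList l) (s : ℤ) :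
    StrictAnti (betaSet l s) := by
  intro i j hij
  have := hl.getD_antitone hij.le
  simp only [betaSet] at *
  omega

theorem IsPartitionList.eventually_betaSet_le {l : List ℕ} (hl : IsPartitionList l) (s z : ℤ) :
    ∀ᶠ P : ℕ in Filter.atTop, ∀ j, P ≤ j → betaSet l s j ≤ z := by
  filter_upwards [Filter.eventually_ge_atTop ((l.getD 0 0 : ℤ) + s - z).toNat] with P hP j hj
  have := hl.getD_antitone (Nat.zero_le j)
  simp only [betaSet] at *
  omega

theorem bind_pure_natCast (l : List ℕ) :
    (do let a ← l; pure (a : ℚ)) = l.map (Nat.cast : ℕ → ℚ) :=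
  List.flatMap_pure_eq_map _ _

theorem domLTn_eq (ρ σ : List ℕ) :
    domLTn ρ σ = domLT (ρ.map (Nat.cast : ℕ → ℚ)) (σ.map (Nat.cast : ℕ → ℚ)) := by
  rw [domLTn, bind_pure_natCast, bind_pure_natCast, List.map_id', List.map_id']

theorem getD_map_cast (l : List ℕ) (j : ℕ) :
    (l.map (Nat.cast : ℕ → ℚ)).getD j 0 = ((l.getD j 0 : ℕ) : ℚ) := by
  rcases lt_or_ge j l.length with hj | hj
  · rw [List.getD_eq_getElem _ _ (by simpa using hj), List.getD_eq_getElem _ _ hj,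
      List.getElem_map]
  · rw [List.getD_eq_default _ _ (by simpa using hj), List.getD_eq_default _ _ hj]
    simp

theorem domLE_map_cast_iff_betaSet (ρ σ : List ℕ) :
    domLE (ρ.map (Nat.cast : ℕ → ℚ)) (σ.map (Nat.cast : ℕ → ℚ)) ↔
      ∀ i, ∑ j ∈ Finset.range i, (betaSet ρ 0 j : ℚ) ≤
        ∑ j ∈ Finset.range i, (betaSet σ 0 j : ℚ) := by
  simp only [domLE, getD_map_cast, betaSet]
  push_cast
  simp [Finset.sum_sub_distrib]

/-- The entries of two conjugate partitions, read as positions of beads and of gaps, fill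
an interval of integers. -/
theorem sum_add_sum_conj {M : Type*} [AddCommMonoid M] {l l' : List ℕ} (hl : IsPartitionList l)
    (hl' : IsPartitionList l') (hconj : IsConjPart l l') {N P : ℕ} (hN : l.length ≤ N)
    (hP : l.getD 0 0 ≤ P) (g : ℤ → M) :
    ∑ j ∈ Finset.range N, g ((l.getD j 0 : ℤ) - (j + 1)) +
      ∑ j ∈ Finset.range P, g ((j : ℤ) - l'.getD j 0) = ∑ k ∈ Finset.Ico (-(N : ℤ)) P, g k := by
  have inj1 : Function.Injective fun j : ℕ => (l.getD j 0 : ℤ) - (j + 1) := by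
    have := (hl.betaSet_strictAnti (-1)).injective
    intro i j hij
    apply this
    simp only [betaSet] at *
    omega
  have inj2 : Function.Injective fun j : ℕ => (j : ℤ) - l'.getD j 0 := by
    have := (hl'.betaSet_strictAnti 0).injective
    intro i j hij
    apply this
    simp only [betaSet] at *
    omega
  have hl'N : ∀ j, l'.getD j 0 ≤ N := by
    intro j
    by_contra h
    have h1 := (hconj N j).2 (not_le.1 h)
    rw [List.getD_eq_default _ _ hN] at h1
    omega
  set A := (Finset.range N).image fun j : ℕ => (l.getD j 0 : ℤ) - (j + 1) with hA
  set B := (Finset.range P).image fun j : ℕ => (j : ℤ) - l'.getD j 0 with hB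
  have hdisj : Disjoint A B := by
    rw [Finset.disjoint_left]
    intro x hxA hxB
    obtain ⟨i, -, rfl⟩ := Finset.mem_image.1 hxA
    obtain ⟨j, -, hj⟩ := Finset.mem_image.1 hxB
    have := hconj i j
    omega
  have hsub : A ∪ B ⊆ Finset.Ico (-(N : ℤ)) P := by
    intro x hx
    rw [Finset.mem_Ico]
    rcases Finset.mem_union.1 hx with hx | hx
    · obtain ⟨i, hi, rfl⟩ := Finset.mem_image.1 hx
      have h1 := hl.getD_antitone (Nat.zero_le i)
      have h2 := Finset.mem_range.1 hi
      simp only at h1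
      omega
    · obtain ⟨j, hj, rfl⟩ := Finset.mem_image.1 hx
      have h1 := hl'N j
      have h2 := Finset.mem_range.1 hj
      omega
  have hunion : A ∪ B = Finset.Ico (-(N : ℤ)) P := by
    refine Finset.eq_of_subset_of_card_le hsub ?_
    rw [Finset.card_union_of_disjoint hdisj, hA, hB, Finset.card_image_of_injective _ inj1,
      Finset.card_image_of_injective _ inj2, Finset.card_range, Finset.card_range, Int.card_Ico]
    omega
  rw [← hunion, Finset.sum_union hdisj, hA, hB, Finset.sum_image inj1.injOn,
    Finset.sum_image inj2.injOn]

theorem sum_posPart_row {l l' : List ℕ} (hl : IsPartitionList l)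
    (hl' : IsPartitionList l') (hconj : IsConjPart l l') {N P : ℕ} (hN : l.length ≤ N)
    (hP : l.getD 0 0 ≤ P) (c : ℚ) :
    ∑ j ∈ Finset.range N, max ((l.getD j 0 : ℚ) - (j + 1) - c) 0 +
      ∑ j ∈ Finset.range P, max (c - ((j : ℚ) - l'.getD j 0)) 0 =
    (l.sum : ℚ) + (∑ j ∈ Finset.range N, (-((j : ℚ) + 1) - c) +
      ∑ k ∈ Finset.Ico (-(N : ℤ)) P, max (c - (k : ℚ)) 0) := by
  have h := sum_add_sum_conj hl hl' hconj hN hP fun k : ℤ => max (c - (k : ℚ)) 0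
  rw [← h, List.sum_eq_sum_range_getD_of_le _ hN]
  push_cast
  rw [← add_assoc, ← add_assoc, ← Finset.sum_add_distrib, ← Finset.sum_add_distrib]
  congr 1
  refine Finset.sum_congr rfl fun j _ => ?_
  rcases le_total ((l.getD j 0 : ℚ) - (j + 1)) c with h | h
  · rw [max_eq_right (by linarith), max_eq_left (by linarith)]
    ring
  · rw [max_eq_left (by linarith), max_eq_right (by linarith)]
    ring

/-! ### Symbols -/

theorem length_le_floor {d : ℤ} {m : ℚ} {l : List ℕ} (hd : (l.length : ℚ) - m + 1 ≤ d) :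
    l.length ≤ ⌊(d : ℚ) + m⌋.toNat := by
  have : (l.length : ℤ) ≤ ⌊(d : ℚ) + m⌋ := Int.le_floor.2 (by push_cast; linarith)
  omega

theorem sum_map_symbolRow {M : Type*} [AddCommMonoid M] {d : ℤ} {m : ℚ} {l : List ℕ}
    (hd : (l.length : ℚ) - m + 1 ≤ d) (g : ℚ → M) :
    ((symbolRow d m l).map g).sum =
      ∑ j ∈ Finset.range ⌊(d : ℚ) + m⌋.toNat, g ((l.getD j 0 : ℚ) - (j + 1) + (d + m)) := by
  have hfl : ⌊(d : ℚ) - l.length + m⌋ = ⌊(d : ℚ) + m⌋ - l.length := by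
    rw [← Int.floor_sub_natCast]
    congr 1
    ring
  have hlen := length_le_floor hd
  set F := ⌊(d : ℚ) + m⌋ with hF
  obtain ⟨f, hf⟩ := Nat.exists_eq_add_of_le hlen
  have hFf : F = l.length + f := by
    have : (1 : ℤ) ≤ ⌊(d : ℚ) - l.length + m⌋ := Int.le_floor.2 (by push_cast; linarith)
    omega
  rw [symbolRow, shiftRow, if_neg (by linarith), hfl, hf, Finset.sum_range_add, betaRow,
    show F - (l.length : ℤ) = f by omega, List.map_append, List.sum_append, add_comm]
  congr 1
  · rw [List.map_map, List.map_map, List.sum_map_range, ← Finset.sum_range_reflect]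
    refine Finset.sum_congr rfl fun j hj => ?_
    have hj' := Finset.mem_range.1 hj
    have e : l.length - 1 - (l.length - 1 - j) = j := by omega
    have e' : ((l.length - 1 - j : ℕ) : ℚ) = l.length - 1 - j := by
      rw [Nat.cast_sub (by omega), Nat.cast_sub (by omega), Nat.cast_one]
    simp only [Function.comp_apply, e, e']
    congr 1
    ring
  · rw [bind_pure_natCast, List.map_map, List.map_map, List.sum_map_range, Int.toNat_natCast, ← Finset.sum_range_reflect]
    refine Finset.sum_congr rfl fun j hj => ?_
    have hj' := Finset.mem_range.1 hj
    have e' : ((f - 1 - j : ℕ) : ℚ) = f - 1 - j := by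
      rw [Nat.cast_sub (by omega), Nat.cast_sub (by omega), Nat.cast_one]
    rw [List.getD_eq_default _ _ (Nat.le_add_right _ _), Function.comp_apply, Function.comp_apply, e']
    congr 1
    push_cast
    ring

theorem sum_map_kappa {M : Type*} [AddCommMonoid M] {ℓ : ℕ} {d : ℤ} {m : Fin ℓ → ℚ}
    {lam : Fin ℓ → List ℕ} (hd : ∀ i, ((lam i).length : ℚ) - m i + 1 ≤ d) (g : ℚ → M) :
    ((kappa ℓ d m lam).map g).sum = ∑ i, ∑ j ∈ Finset.range ⌊(d : ℚ) + m i⌋.toNat,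
      g (((lam i).getD j 0 : ℚ) - (j + 1) + (d + m i)) := by
  rw [kappa, ((List.perm_insertionSort _ _).map g).sum_eq, List.map_flatMap, List.flatMap_def,
    List.sum_flatten, List.map_map]
  rw [Fin.sum_univ_def]
  exact congrArg List.sum (List.map_congr_left fun i _ => sum_map_symbolRow (hd i) g)

theorem kappa_pairwise (ℓ : ℕ) (d : ℤ) (m : Fin ℓ → ℚ) (lam : Fin ℓ → List ℕ) :
    (kappa ℓ d m lam).Pairwise (· ≥ ·) :=
  List.pairwise_insertionSort (fun a b : ℚ => b ≤ a) _

theorem length_kappa {ℓ : ℕ} {d : ℤ} {m : Fin ℓ → ℚ} {lam : Fin ℓ → List ℕ}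
    (hd : ∀ i, ((lam i).length : ℚ) - m i + 1 ≤ d) :
    (kappa ℓ d m lam).length = ∑ i, ⌊(d : ℚ) + m i⌋.toNat := by
  have := sum_map_kappa hd fun _ => 1
  simpa using this

theorem sum_posPart_kappa {ℓ n : ℕ} {d : ℤ} {m : Fin ℓ → ℚ} {lam tlam : Fin ℓ → List ℕ}
    (hlam : ∀ i, IsPartitionList (lam i)) (hlamn : ∑ i, (lam i).sum = n)
    (hd : ∀ i, ((lam i).length : ℚ) - m i + 1 ≤ d)
    (htlam : ∀ i, IsPartitionList (tlam i)) (hconj : ∀ i, IsConjPart (lam i) (tlam i))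
    {P : ℕ} (hP : ∀ i, (lam i).getD 0 0 ≤ P) (c : ℚ) :
    ((kappa ℓ d m lam).map fun x => max (x - c) 0).sum +
      ∑ i, ∑ j ∈ Finset.range P, max (c - (d + m i) - ((j : ℚ) - (tlam i).getD j 0)) 0 =
    n + ∑ i, (∑ j ∈ Finset.range ⌊(d : ℚ) + m i⌋.toNat, (-((j : ℚ) + 1) - (c - (d + m i))) +
      ∑ k ∈ Finset.Ico (-(⌊(d : ℚ) + m i⌋.toNat : ℤ)) P, max (c - (d + m i) - (k : ℚ)) 0) := by
  rw [sum_map_kappa hd, ← hlamn]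
  rw [Nat.cast_sum, ← Finset.sum_add_distrib, ← Finset.sum_add_distrib]
  refine Finset.sum_congr rfl fun i _ => ?_
  rw [← sum_posPart_row (hlam i) (htlam i) (hconj i) (length_le_floor (hd i)) (hP i)]
  congr 1
  refine Finset.sum_congr rfl fun j _ => ?_
  congr 1
  ring

/-! ### Comparison with `τ` -/

theorem sum_posPart_eq_of_range_eq {α β : Type*} {u : α → ℤ} {v : β → ℤ}
    (hu : Function.Injective u) (hv : Function.Injective v) (h : Set.range u = Set.range v)
    {A : Finset α} {B : Finset β} {c : ℚ} (hA : ∀ a ∉ A, (u a : ℚ) ≤ c)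
    (hB : ∀ b ∉ B, (v b : ℚ) ≤ c) :
    ∑ a ∈ A, max ((u a : ℚ) - c) 0 = ∑ b ∈ B, max ((v b : ℚ) - c) 0 := by
  have e1 : ∑ᶠ a, max ((u a : ℚ) - c) 0 = ∑ a ∈ A, max ((u a : ℚ) - c) 0 :=
    finsum_eq_sum_of_support_subset _ fun a ha => by
      by_contra h'
      exact ha (max_eq_right (sub_nonpos.2 (hA a h')))
  have e2 : ∑ᶠ b, max ((v b : ℚ) - c) 0 = ∑ b ∈ B, max ((v b : ℚ) - c) 0 :=
    finsum_eq_sum_of_support_subset _ fun b hb => by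
      by_contra h'
      exact hb (max_eq_right (sub_nonpos.2 (hB b h')))
  rw [← e1, ← e2, ← finsum_mem_range (f := fun z : ℤ => max ((z : ℚ) - c) 0) hu,
    ← finsum_mem_range (f := fun z : ℤ => max ((z : ℚ) - c) 0) hv, h]

/-- The elements of `tauSet`, indexed by the row and the position in the row. -/
def tauElem (ℓ : ℕ) (s : Fin ℓ → ℤ) (lam : Fin ℓ → List ℕ) (p : Fin ℓ × ℕ) : ℤ :=
  ℓ * (betaSet (lam p.1) (s p.1) p.2 - 1) + ((p.1 : ℕ) + 1)

theorem range_tauElem (ℓ : ℕ) (s : Fin ℓ → ℤ) (lam : Fin ℓ → List ℕ) :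
    Set.range (tauElem ℓ s lam) = tauSet ℓ s lam := by
  ext x
  simp [tauSet, tauElem]

theorem tauElem_injective {ℓ : ℕ} {s : Fin ℓ → ℤ} {lam : Fin ℓ → List ℕ}
    (hlam : ∀ i, IsPartitionList (lam i)) : Function.Injective (tauElem ℓ s lam) := by
  rintro ⟨i, j⟩ ⟨i', j'⟩ h
  simp only [tauElem] at h
  have hi := i.2
  have hi' := i'.2
  set x := betaSet (lam i) (s i) j - 1 with hx
  set x' := betaSet (lam i') (s i') j' - 1 with hx'
  have hxx : x = x' := by
    have hpos : (0 : ℤ) < ℓ := by omega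
    rcases lt_trichotomy x x' with hlt | heq | hlt
    · nlinarith
    · exact heq
    · nlinarith
  rw [hxx] at h
  obtain rfl : i = i' := Fin.ext (by omega)
  exact congrArg (Prod.mk i) (((hlam i).betaSet_strictAnti (s i)).injective (by omega))

theorem eventually_tauElem_le {ℓ : ℕ} (s : Fin ℓ → ℤ) {lam : Fin ℓ → List ℕ}
    (hlam : ∀ i, IsPartitionList (lam i)) (c : ℚ) :
    ∀ᶠ P : ℕ in Filter.atTop, ∀ i j, P ≤ j → (tauElem ℓ s lam (i, j) : ℚ) ≤ c := by
  refine Filter.eventually_all.2 fun i => ?_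
  filter_upwards [(hlam i).eventually_betaSet_le (s i) (min 0 ⌊c⌋)] with P hP j hj
  have h1 := hP j hj
  rw [← Int.le_floor]
  have h2 := h1.trans (min_le_left _ _)
  have h3 := h1.trans (min_le_right _ _)
  have hi := i.2
  simp only [tauElem]
  nlinarith

theorem domLE_cast_iff_domLE_kappa (ℓ n : ℕ) (hℓ : 1 ≤ ℓ) (s : Fin ℓ → ℤ)
    (lam mu : Fin ℓ → List ℕ)
    (hlam : ∀ i, IsPartitionList (lam i)) (hmu : ∀ i, IsPartitionList (mu i))
    (hlamn : ∑ i, (lam i).sum = n) (hmun : ∑ i, (mu i).sum = n)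
    (m : Fin ℓ → ℚ) (hm : ∀ i : Fin ℓ, m i = -(s i : ℚ) - ((i : ℕ) : ℚ) / (ℓ : ℚ))
    (d : ℤ)
    (hdlam : ∀ i, ((lam i).length : ℚ) - m i + 1 ≤ (d : ℚ))
    (hdmu : ∀ i, ((mu i).length : ℚ) - m i + 1 ≤ (d : ℚ))
    (tlam tmu : Fin ℓ → List ℕ)
    (htlam : ∀ i, IsPartitionList (tlam i)) (htmu : ∀ i, IsPartitionList (tmu i))
    (hconjlam : ∀ i, IsConjPart (lam i) (tlam i))
    (hconjmu : ∀ i, IsConjPart (mu i) (tmu i))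
    (ρ σ : List ℕ) (hρ : IsPartitionList ρ) (hσ : IsPartitionList σ)
    (hτρ : Set.range (betaSet ρ 0) = tauSet ℓ s tlam)
    (hτσ : Set.range (betaSet σ 0) = tauSet ℓ s tmu) :
    domLE (ρ.map (Nat.cast : ℕ → ℚ)) (σ.map (Nat.cast : ℕ → ℚ)) ↔
      domLE (kappa ℓ d m mu) (kappa ℓ d m lam) := by
  have hℓ0 : (0 : ℚ) < ℓ := by exact_mod_cast hℓ
  have key : ∀ c : ℚ, ∀ᶠ K : ℕ in Filter.atTop,
      (∑ j ∈ Finset.range K, max ((betaSet ρ 0 j : ℚ) - (ℓ * d - ℓ + 1 - ℓ * c)) 0 ≤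
        ∑ j ∈ Finset.range K, max ((betaSet σ 0 j : ℚ) - (ℓ * d - ℓ + 1 - ℓ * c)) 0 ↔
      ((kappa ℓ d m mu).map fun x => max (x - c) 0).sum ≤
        ((kappa ℓ d m lam).map fun x => max (x - c) 0).sum) := by
    intro c
    set c' : ℚ := ℓ * d - ℓ + 1 - ℓ * c with hc'
    have conv : ∀ (t : Fin ℓ → List ℕ) (ht : ∀ i, IsPartitionList (t i)) (r : List ℕ)
        (hr : IsPartitionList r) (hτ : Set.range (betaSet r 0) = tauSet ℓ s t),
        ∀ᶠ P : ℕ in Filter.atTop, ∑ j ∈ Finset.range P, max ((betaSet r 0 j : ℚ) - c') 0 =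
          ℓ * ∑ i, ∑ j ∈ Finset.range P,
            max (c - (d + m i) - ((j : ℚ) - (t i).getD j 0)) 0 := by
      intro t ht r hr hτ
      filter_upwards [eventually_tauElem_le s ht c', hr.eventually_betaSet_le 0 ⌊c'⌋]
        with P hP1 hP2
      rw [sum_posPart_eq_of_range_eq (hr.betaSet_strictAnti 0).injective
        (tauElem_injective (s := s) ht) (hτ.trans (range_tauElem ℓ s t).symm)
        (A := Finset.range P) (B := Finset.univ ×ˢ Finset.range P)
        (fun j hj => Int.le_floor.1 (hP2 j (by simpa using hj)))
        (fun p hp => hP1 p.1 p.2 (by simpa using hp)), Finset.sum_product, Finset.mul_sum]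
      refine Finset.sum_congr rfl fun i _ => ?_
      rw [Finset.mul_sum]
      refine Finset.sum_congr rfl fun j _ => ?_
      rw [mul_max_of_nonneg _ _ hℓ0.le, mul_zero, hm i]
      congr 1
      simp only [tauElem, betaSet, hc']
      push_cast
      field_simp
      ring
    have hbig : ∀ (t : Fin ℓ → List ℕ), ∀ᶠ P : ℕ in Filter.atTop, ∀ i, (t i).getD 0 0 ≤ P :=
      fun t => Filter.eventually_all.2 fun i => Filter.eventually_ge_atTop _
    filter_upwards [conv tlam htlam ρ hρ hτρ, conv tmu htmu σ hσ hτσ, hbig lam, hbig mu]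
      with P h1 h2 h3 h4
    have k1 := sum_posPart_kappa hlam hlamn hdlam htlam hconjlam h3 c
    have k2 := sum_posPart_kappa hmu hmun hdmu htmu hconjmu h4 c
    rw [h1, h2, mul_le_mul_iff_right₀ hℓ0]
    constructor <;> intro h <;> linarith
  rw [domLE_map_cast_iff_betaSet, domLE_iff_sum_posPart (kappa_pairwise ..) (kappa_pairwise ..)
    ((length_kappa hdmu).trans (length_kappa hdlam).symm)]
  have anti : ∀ r : List ℕ, IsPartitionList r → ∀ N i j : ℕ, i ≤ j → j < N →
      (betaSet r 0 j : ℚ) ≤ betaSet r 0 i := fun r hr N i j hij _ =>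
    Int.cast_le.2 ((hr.betaSet_strictAnti 0).antitone hij)
  constructor
  · intro h c
    obtain ⟨K, hK⟩ := (key c).exists
    exact hK.1 (sum_posPart_le_of_partial_sums (anti ρ hρ K) (fun i _ => h i) _)
  · intro h i
    rcases i with _ | i
    · simp
    · obtain ⟨K, hK, hiK⟩ := ((key ((ℓ * d - ℓ + 1 - betaSet σ 0 i) / ℓ)).and
        (Filter.eventually_gt_atTop i)).exists
      refine partial_sum_le_of_sum_posPart hiK (anti σ hσ K) ?_
      have e : (ℓ * d - ℓ + 1 - ℓ * ((ℓ * d - ℓ + 1 - betaSet σ 0 i) / ℓ) : ℚ) =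
          betaSet σ 0 i := by
        field_simp
        ring
      rw [e] at hK
      exact hK.2 (h _)

/-- For `s ∈ ℤ₀^ℓ` and `mⁱ = −sᵢ − i/ℓ` :
`τ_s(ᵗλ) ⊲ τ_s(ᵗμ) ⟺ κ^d_m(μ) ⊲ κ^d_m(λ)`, where `ᵗλ` is the componentwise
conjugate multipartition and `τ` is characterized by the property that its β-set
`β₀` has range the set `𝒯`. -/
theorem statement15 (ℓ n : ℕ) (hℓ : 1 ≤ ℓ) (s : Fin ℓ → ℤ) (hsum : ∑ i, s i = 0)
    (lam mu : Fin ℓ → List ℕ)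
    (hlam : ∀ i, IsPartitionList (lam i)) (hmu : ∀ i, IsPartitionList (mu i))
    (hlamn : ∑ i, (lam i).sum = n) (hmun : ∑ i, (mu i).sum = n)
    (m : Fin ℓ → ℚ) (hm : ∀ i : Fin ℓ, m i = -(s i : ℚ) - ((i : ℕ) : ℚ) / (ℓ : ℚ))
    (d : ℤ)
    (hdlam : ∀ i, ((lam i).length : ℚ) - m i + 1 ≤ (d : ℚ))
    (hdmu : ∀ i, ((mu i).length : ℚ) - m i + 1 ≤ (d : ℚ))
    (tlam tmu : Fin ℓ → List ℕ)
    (htlam : ∀ i, IsPartitionList (tlam i)) (htmu : ∀ i, IsPartitionList (tmu i))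
    (hconjlam : ∀ i, IsConjPart (lam i) (tlam i))
    (hconjmu : ∀ i, IsConjPart (mu i) (tmu i))
    (ρ σ : List ℕ) (hρ : IsPartitionList ρ) (hσ : IsPartitionList σ)
    (hτρ : Set.range (betaSet ρ 0) = tauSet ℓ s tlam)
    (hτσ : Set.range (betaSet σ 0) = tauSet ℓ s tmu) :
    domLTn ρ σ ↔ domLT (kappa ℓ d m mu) (kappa ℓ d m lam) := by
  have h1 := domLE_cast_iff_domLE_kappa ℓ n hℓ s lam mu hlam hmu hlamn hmun m hm d hdlam hdmu
    tlam tmu htlam htmu hconjlam hconjmu ρ σ hρ hσ hτρ hτσ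
  have h2 := domLE_cast_iff_domLE_kappa ℓ n hℓ s mu lam hmu hlam hmun hlamn m hm d hdmu hdlam
    tmu tlam htmu htlam hconjmu hconjlam σ ρ hσ hρ hτσ hτρ
  rw [domLTn_eq, domLT, domLT, h1]
  refine and_congr_right fun hle => not_congr ⟨fun heq => ?_, fun heq => ?_⟩
  · have hle' := h2.1 (heq ▸ fun _ => le_rfl)
    have hlen := (length_kappa hdmu).trans (length_kappa hdlam).symm
    refine List.ext_getElem hlen fun j hj hj' => ?_
    have := getD_eq_of_domLE hle hle' j
    rwa [List.getD_eq_getElem _ _ hj, List.getD_eq_getElem _ _ hj'] at this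
  · have hle' := h2.2 (heq ▸ fun _ => le_rfl)
    rw [hρ.ext hσ fun j => ?_]
    have := getD_eq_of_domLE (h1.2 hle) hle' j
    rw [getD_map_cast, getD_map_cast] at this
    exact_mod_cast this
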